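/- Quantization dimension of Markov-type measures on Mauldin–Williams fractals: Let N ≥ 2, let P = (p_ij) be an N×N row-stochastic matrix such that each row has at least two positive entries (A1), and let (J_σ)_{σ∈Ω*} be cylinder sets in ℝ^d as in the ratio-specified Mauldin–Williams construction: the J_i (1≤i≤N) are non-empty compact sets equal to the closures of their interiors, J_{σ*j} ⊆ J_σ is geometrically similar to J_j with |J_{σ*i_k j}|/|J_σ| ... determined by ratios c_ij ∈ (0,1) via |J_{σ*j}| = c_{σ_k j}|J_σ| for σ ∈ Ω_k ending in σ_k, and assume the separation condition (A2): there is t ∈ (0,1) with d(J_{σ*i₁}, J_{σ*i₂}) ≥ t·max{|J_{σ*i₁}|, |J_{σ*i₂}|} for all admissible σ and distinct i₁, i₂. Let (χ_i)_{i=1}^N be a probability vector with all χ_i > 0 and let μ be the Markov-type measure determined by μ(J_σ) = χ_{σ₁} p_{σ₁σ₂} ⋯ p_{σ_{k−1}σ_k} for σ = (σ₁,…,σ_k) ∈ Ω_k. Fix r ∈ (0,∞) and let s_r be the unique positive number such that the spectral radius of the N×N matrix with entries (p_ij c_ij^r)^{s_r/(s_r+r)} equals 1. Then the quantization dimension D_r(μ)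 exists, D_r(μ) = s_r, and Q̲_r^{s_r}(μ) > 0. -/

import Mathlib

open MeasureTheory Filter Metric
open scoped ENNReal NNReal

/-- The `n`-th quantization error of order `r` for a measure `P`:
`e_{n,r}(P) = inf { (∫ d(x,α)^r dP)^{1/r} : α ⊆ E, 1 ≤ card α ≤ n }`. -/
noncomputable def quantError {E : Type*} [MetricSpace E] [MeasurableSpace E]
    (P : Measure E) (r : ℝ) (n : ℕ) : ℝ :=
  sInf {e : ℝ | ∃ α : Finset E, 1 ≤ α.card ∧ α.card ≤ n ∧
    e = (∫ x, infDist x (↑α : Set E) ^ r ∂P) ^ (1 / r)}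

/-- The upper quantization dimension of order `r`. -/
noncomputable def upperQuantDim {E : Type*} [MetricSpace E] [MeasurableSpace E]
    (P : Measure E) (r : ℝ) : ℝ :=
  limsup (fun n : ℕ => Real.log n / (- Real.log (quantError P r n))) atTop

/-- The lower quantization dimension of order `r`. -/
noncomputable def lowerQuantDim {E : Type*} [MetricSpace E] [MeasurableSpace E]
    (P : Measure E) (r : ℝ) : ℝ :=
  liminf (fun n : ℕ => Real.log n / (- Real.log (quantError P r n))) atTop

/-- The `s`-dimensional upper quantization coefficient of order `r`. -/
noncomputable def upperQuantCoeff {E : Type*} [MetricSpace E] [MeasurableSpace E]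
    (P : Measure E) (r s : ℝ) : ℝ≥0∞ :=
  limsup (fun n : ℕ => ENNReal.ofReal ((n : ℝ) ^ (1 / s) * quantError P r n)) atTop

/-- The `s`-dimensional lower quantization coefficient of order `r`. -/
noncomputable def lowerQuantCoeff {E : Type*} [MetricSpace E] [MeasurableSpace E]
    (P : Measure E) (r s : ℝ) : ℝ≥0∞ :=
  liminf (fun n : ℕ => ENNReal.ofReal ((n : ℝ) ^ (1 / s) * quantError P r n)) atTop

/-- A word `σ = σ₁…σ_k` is admissible when all transition probabilities along it are
positive (this also makes every word of length `≤ 1` admissible). -/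
def Adm {N : ℕ} (p : Fin N → Fin N → ℝ) (σ : List (Fin N)) : Prop :=
  List.Chain' (fun a b => 0 < p a b) σ

/-- The Markov mass `χ_{σ₁} p_{σ₁σ₂} ⋯ p_{σ_{k-1}σ_k}` of a cylinder word `σ`. -/
noncomputable def cylMass {N : ℕ} (χ : Fin N → ℝ) (p : Fin N → Fin N → ℝ) :
    List (Fin N) → ℝ
  | [] => 1
  | a :: l => χ a * (((a :: l).zip l).map (fun ab => p ab.1 ab.2)).prod


lemma cut_exists {α : Type*} [Fintype α] [DecidableEq α] (G : List α → Prop) [DecidablePred G]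
    (H : List α → ℝ) (θ η ε : ℝ) (hη : 0 ≤ η)
    (hlo : ∀ σ j, G (σ ++ [j]) → η * H σ ≤ H (σ ++ [j]))
    (hhi : ∀ σ j, G (σ ++ [j]) → H (σ ++ [j]) ≤ θ * H σ) (hθ : 0 ≤ θ) (K : ℕ) :
    ∀ σ, G σ → ε ≤ H σ → θ ^ K * H σ < ε → ∃ Λ : Finset (List α),
      (∀ τ ∈ Λ, G τ ∧ (∃ j, σ ++ [j] <+: τ) ∧ H τ < ε ∧ η * ε ≤ H τ) ∧
      (∀ τ ∈ Λ, ∀ τ' ∈ Λ, τ ≠ τ' → ∃ ω i j, i ≠ j ∧ G (ω ++ [i]) ∧ G (ω ++ [j]) ∧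
        ω ++ [i] <+: τ ∧ ω ++ [j] <+: τ') ∧
      ∀ w : List α → ℝ, (∀ ω, G ω →
        w ω ≤ ∑ j ∈ Finset.univ.filter (fun j => G (ω ++ [j])), w (ω ++ [j])) →
        w σ ≤ ∑ τ ∈ Λ, w τ := by
  induction K with
  | zero => intro σ _ h1 h2; simp at h2; linarith
  | succ K ih =>
    intro σ hσ h1 h2
    have key : ∀ j, ∃ Λ : Finset (List α), G (σ ++ [j]) →
        ((∀ τ ∈ Λ, G τ ∧ σ ++ [j] <+: τ ∧ H τ < ε ∧ η * ε ≤ H τ) ∧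
        (∀ τ ∈ Λ, ∀ τ' ∈ Λ, τ ≠ τ' → ∃ ω i j, i ≠ j ∧ G (ω ++ [i]) ∧ G (ω ++ [j]) ∧
          ω ++ [i] <+: τ ∧ ω ++ [j] <+: τ') ∧
        ∀ w : List α → ℝ, (∀ ω, G ω →
          w ω ≤ ∑ j ∈ Finset.univ.filter (fun j => G (ω ++ [j])), w (ω ++ [j])) →
          w (σ ++ [j]) ≤ ∑ τ ∈ Λ, w τ) := by
      intro j
      by_cases hG : G (σ ++ [j])
      swap
      · exact ⟨∅, fun h => absurd h hG⟩
      by_cases hε : H (σ ++ [j]) < ε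
      · refine ⟨{σ ++ [j]}, fun _ => ⟨?_, ?_, ?_⟩⟩
        · intro τ hτ
          rw [Finset.mem_singleton] at hτ
          subst hτ
          exact ⟨hG, List.prefix_refl _, hε,
            (mul_le_mul_of_nonneg_left h1 hη).trans (hlo σ j hG)⟩
        · intro τ hτ τ' hτ' hne
          rw [Finset.mem_singleton] at hτ hτ'
          exact absurd (hτ.trans hτ'.symm) hne
        · intro w _
          simp
      · have h3 : θ ^ K * H (σ ++ [j]) < ε := by
          refine lt_of_le_of_lt ?_ h2
          rw [pow_succ, mul_assoc]
          exact mul_le_mul_of_nonneg_left (hhi σ j hG) (pow_nonneg hθ _)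
        obtain ⟨Λ, a, b, c⟩ := ih _ hG (not_lt.mp hε) h3
        refine ⟨Λ, fun _ => ⟨?_, b, c⟩⟩
        intro τ hτ
        obtain ⟨g1, ⟨k, g2⟩, g3, g4⟩ := a τ hτ
        exact ⟨g1, (List.prefix_append _ _).trans g2, g3, g4⟩
    choose L hL using key
    refine ⟨(Finset.univ.filter (fun j => G (σ ++ [j]))).biUnion L, ?_, ?_, ?_⟩
    · intro τ hτ
      simp only [Finset.mem_biUnion, Finset.mem_filter, Finset.mem_univ, true_and] at hτ
      obtain ⟨j, hj, hτ⟩ := hτ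
      obtain ⟨g1, g2, g3, g4⟩ := (hL j hj).1 τ hτ
      exact ⟨g1, ⟨j, g2⟩, g3, g4⟩
    · intro τ hτ τ' hτ' hne
      simp only [Finset.mem_biUnion, Finset.mem_filter, Finset.mem_univ, true_and] at hτ hτ'
      obtain ⟨j, hj, hτ⟩ := hτ
      obtain ⟨j', hj', hτ'⟩ := hτ'
      by_cases hjj : j = j'
      · subst hjj
        exact (hL j hj).2.1 τ hτ τ' hτ' hne
      · exact ⟨σ, j, j', hjj, hj, hj', ((hL j hj).1 τ hτ).2.1, ((hL j' hj').1 τ' hτ').2.1⟩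
    · intro w hw
      rw [Finset.sum_biUnion]
      · refine (hw σ hσ).trans (Finset.sum_le_sum ?_)
        intro j hj
        simp only [Finset.mem_filter, Finset.mem_univ, true_and] at hj
        exact (hL j hj).2.2 w hw
      · intro j hj j' hj' hjj
        simp only [Finset.coe_filter, Finset.mem_univ, true_and, Set.mem_ofPred_eq] at hj hj'
        rw [Function.onFun, Finset.disjoint_left]
        intro τ hτ hτ'
        have e1 := ((hL j hj).1 τ hτ).2.1
        have e2 := ((hL j' hj').1 τ hτ').2.1
        have := List.prefix_of_prefix_length_le e1 e2 (by simp)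
        have := this.eq_of_length (by simp)
        simp at this
        exact hjj this

lemma sup_vec {N : ℕ} (A : Fin N → Fin N → ℝ) (hA : ∀ i j, 0 ≤ A i j)
    (hspec : spectralRadius ℂ (Matrix.of fun i j : Fin N => ((A i j : ℝ) : ℂ)) = 1) :
    ∃ v : Fin N → ℝ, (∀ i, 0 ≤ v i) ∧ (∃ i, 0 < v i) ∧ ∀ i, v i ≤ ∑ j, A i j * v j := by
  set M := (Matrix.of fun i j : Fin N => ((A i j : ℝ) : ℂ)) with hM
  let _ := Matrix.linftyOpNormedRing (n := Fin N) (α := ℂ)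
  let _ := Matrix.linftyOpNormedAlgebra (R := ℂ) (n := Fin N) (α := ℂ)
  have _ : CompleteSpace (Matrix (Fin N) (Fin N) ℂ) := FiniteDimensional.complete ℂ _
  have hne : (spectrum ℂ M).Nonempty := by
    by_contra h
    rw [Set.not_nonempty_iff_eq_empty] at h
    simp [spectralRadius, h] at hspec
  obtain ⟨k, hk, hk1⟩ := spectrum.exists_nnnorm_eq_spectralRadius_of_nonempty hne
  rw [hspec] at hk1
  have hk1 : ‖k‖ = 1 := by
    have : ‖k‖₊ = 1 := by exact_mod_cast hk1
    simpa using congrArg NNReal.toReal this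
  rw [← Matrix.spectrum_toLin', ← Module.End.hasEigenvalue_iff_mem_spectrum] at hk
  obtain ⟨u, hu⟩ := hk.exists_hasEigenvector
  have h1 := hu.apply_eq_smul
  refine ⟨fun i => ‖u i‖, fun i => norm_nonneg _, ?_, ?_⟩
  · obtain ⟨i, hi⟩ := Function.ne_iff.mp hu.2
    exact ⟨i, norm_pos_iff.mpr hi⟩
  · intro i
    have h2 := congrFun h1 i
    simp only [Matrix.toLin'_apply, Matrix.mulVec, dotProduct, Pi.smul_apply, smul_eq_mul] at h2
    calc ‖u i‖ = ‖k * u i‖ := by rw [norm_mul, hk1, one_mul]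
      _ = ‖∑ j, M i j * u j‖ := by rw [h2]
      _ ≤ ∑ j, ‖M i j * u j‖ := norm_sum_le _ _
      _ = _ := by
        refine Finset.sum_congr rfl fun j _ => ?_
        rw [norm_mul, hM, Matrix.of_apply, Complex.norm_real, Real.norm_of_nonneg (hA i j)]

lemma sub_vec {N : ℕ} (A : Fin N → Fin N → ℝ) (hA : ∀ i j, 0 ≤ A i j)
    (hspec : spectralRadius ℂ (Matrix.of fun i j : Fin N => ((A i j : ℝ) : ℂ)) = 1)
    (κ : ℝ) (hκ0 : 0 < κ) (hκ : κ < 1) :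
    ∃ v : Fin N → ℝ, (∀ i, 1 ≤ v i) ∧ ∀ i, ∑ j, κ * A i j * v j ≤ v i := by
  set M := (Matrix.of fun i j : Fin N => ((A i j : ℝ) : ℂ)) with hM
  let _ := Matrix.linftyOpNormedRing (n := Fin N) (α := ℂ)
  let _ := Matrix.linftyOpNormedAlgebra (R := ℂ) (n := Fin N) (α := ℂ)
  have _ : CompleteSpace (Matrix (Fin N) (Fin N) ℂ) := FiniteDimensional.complete ℂ _
  have hG := spectrum.pow_nnnorm_pow_one_div_tendsto_nhds_spectralRadius M
  rw [hspec] at hG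
  have hlt : (1 : ℝ≥0∞) < ENNReal.ofReal κ⁻¹ := by
    rw [← ENNReal.ofReal_one]
    exact (ENNReal.ofReal_lt_ofReal_iff (by positivity)).mpr ((one_lt_inv₀ hκ0).mpr hκ)
  obtain ⟨m, hm, hm0⟩ := ((hG.eventually (gt_mem_nhds hlt)).and (eventually_ge_atTop 1)).exists
  have hnorm : ‖M ^ m‖ ≤ κ⁻¹ ^ m := by
    have hm' : (0:ℝ) < m := by exact_mod_cast hm0
    have h1 : ((‖M ^ m‖₊ : ℝ≥0∞) ^ (1 / m : ℝ)) ^ (m : ℝ) ≤ (ENNReal.ofReal κ⁻¹) ^ (m : ℝ) :=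
      ENNReal.rpow_le_rpow hm.le hm'.le
    rw [← ENNReal.rpow_mul, one_div_mul_cancel hm'.ne', ENNReal.rpow_one, ENNReal.rpow_natCast,
      ← ENNReal.ofReal_pow (by positivity), ← enorm_eq_nnnorm, ← ofReal_norm_eq_enorm] at h1
    exact (ENNReal.ofReal_le_ofReal_iff (by positivity)).mp h1
  let u : ℕ → Fin N → ℝ := fun k => Nat.rec (fun _ => 1) (fun _ f i => ∑ j, κ * A i j * f j) k
  have hu0 : ∀ i, u 0 i = 1 := fun i => rfl
  have hus : ∀ k i, u (k+1) i = ∑ j, κ * A i j * u k j := fun k i => rfl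
  have hpos : ∀ k i, 0 ≤ u k i := by
    intro k
    induction k with
    | zero => intro i; rw [hu0]; norm_num
    | succ k ih =>
      intro i; rw [hus]
      exact Finset.sum_nonneg fun j _ => mul_nonneg (mul_nonneg hκ0.le (hA i j)) (ih j)
  have hpow : ∀ (k : ℕ) (i : Fin N), Complex.ofReal (u k i) = Complex.ofReal κ ^ k * ∑ j, (M ^ k) i j := by
    intro k
    induction k with
    | zero => intro i; simp [hu0, Matrix.one_apply]
    | succ k ih =>
      intro i
      have hM1 : ∀ j, (M ^ (k + 1)) i j = ∑ l, M i l * (M ^ k) l j := fun j => by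
        rw [pow_succ' M k]; exact Matrix.mul_apply
      rw [hus, Complex.ofReal_sum]
      simp only [hM1]
      rw [Finset.sum_comm, Finset.mul_sum]
      refine Finset.sum_congr rfl fun l _ => ?_
      rw [← Finset.mul_sum, Complex.ofReal_mul, ih l, Complex.ofReal_mul, pow_succ]
      have hMl : M i l = Complex.ofReal (A i l) := rfl
      rw [hMl]
      ring
  have hum : ∀ i, u m i ≤ 1 := by
    intro i
    have h1 : u m i = ‖Complex.ofReal (u m i)‖ := by
      rw [Complex.norm_real, Real.norm_of_nonneg (hpos m i)]
    have h2 : ‖∑ j, (M ^ m) i j‖ ≤ ‖M ^ m‖ := by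
      refine (norm_sum_le _ _).trans ?_
      rw [Matrix.linfty_opNorm_def]
      have := Finset.le_sup (f := fun i => ∑ j, ‖(M ^ m) i j‖₊) (Finset.mem_univ i)
      have := NNReal.coe_le_coe.mpr this
      simpa using this
    rw [h1, hpow, norm_mul, norm_pow, Complex.norm_real, Real.norm_of_nonneg hκ0.le]
    calc κ ^ m * ‖∑ j, (M ^ m) i j‖ ≤ κ ^ m * κ⁻¹ ^ m := by
          have := h2.trans hnorm
          gcongr
      _ = 1 := by rw [← mul_pow, mul_inv_cancel₀ hκ0.ne', one_pow]
  refine ⟨fun i => ∑ k ∈ Finset.range m, u k i, ?_, ?_⟩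
  · intro i
    have h0 := Finset.single_le_sum (f := fun k => u k i) (s := Finset.range m)
      (fun k _ => hpos k i) (Finset.mem_range.mpr hm0)
    exact h0
  · intro i
    have : ∑ j, κ * A i j * ∑ k ∈ Finset.range m, u k j = ∑ k ∈ Finset.range m, u (k+1) i := by
      simp only [hus, Finset.mul_sum]
      rw [Finset.sum_comm]
    rw [this]
    have h1 := Finset.sum_range_succ (fun k => u k i) m
    have h2 := Finset.sum_range_succ' (fun k => u k i) m
    have := hum i
    simp only [hu0] at h2
    linarith

lemma integrable_infDist {E : Type*} [MetricSpace E] [MeasurableSpace E] [BorelSpace E]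
    (μ : Measure E) [IsProbabilityMeasure μ] (r : ℝ) (hr : 0 < r) (S : Set E)
    (hS : Bornology.IsBounded S) (hSμ : ∀ᵐ x ∂μ, x ∈ S) (α : Set E) :
    Integrable (fun x => infDist x α ^ r) μ := by
  rcases α.eq_empty_or_nonempty with h | ⟨a, ha⟩
  · subst h
    simp [infDist_empty]
  obtain ⟨R, hR⟩ := hS.subset_closedBall a
  refine Integrable.of_bound (C := R ^ r) ?_ ?_
  · exact ((continuous_infDist_pt α).rpow_const (fun x => Or.inr hr.le)).aestronglyMeasurable
  · filter_upwards [hSμ] with x hx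
    rw [Real.norm_of_nonneg (Real.rpow_nonneg infDist_nonneg _)]
    refine Real.rpow_le_rpow infDist_nonneg ?_ hr.le
    exact (infDist_le_dist_of_mem ha).trans (hR hx)

lemma quant_lower {E ι : Type*} [MetricSpace E] [MeasurableSpace E] [BorelSpace E]
    (μ : Measure E) [IsProbabilityMeasure μ] (r : ℝ) (hr : 0 < r) (S : Set E)
    (hS : Bornology.IsBounded S) (hSμ : ∀ᵐ x ∂μ, x ∈ S) (Λ : Finset ι) (J : ι → Set E)
    (hJm : ∀ σ ∈ Λ, MeasurableSet (J σ)) (t : ℝ) (ht : 0 < t)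
    (hsep : ∀ σ ∈ Λ, ∀ τ ∈ Λ, σ ≠ τ → ∀ x ∈ J σ, ∀ y ∈ J τ,
      t * max (diam (J σ)) (diam (J τ)) ≤ dist x y)
    (hdiam : ∀ σ ∈ Λ, 0 < diam (J σ)) (b : ℝ) (hb0 : 0 ≤ b)
    (hb : ∀ σ ∈ Λ, b ≤ μ.real (J σ) * diam (J σ) ^ r) (α : Finset E) (hα : α.Nonempty) :
    ((Λ.card : ℝ) - α.card) * ((t / 2) ^ r * b) ≤ ∫ x, infDist x (α : Set E) ^ r ∂μ := by
  classical
  have hInt := integrable_infDist μ r hr S hS hSμ (α : Set E)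
  let bad : Finset ι := Λ.filter (fun σ => ∃ a ∈ α, ∃ x ∈ J σ, dist x a < t / 2 * diam (J σ))
  let good : Finset ι := Λ.filter (fun σ => ¬ ∃ a ∈ α, ∃ x ∈ J σ, dist x a < t / 2 * diam (J σ))
  have hbad : bad.card ≤ α.card := by
    have : ∀ σ ∈ bad, ∃ a ∈ α, ∃ x ∈ J σ, dist x a < t / 2 * diam (J σ) := fun σ hσ =>
      (Finset.mem_filter.mp hσ).2
    have hE : Nonempty E := ⟨hα.choose⟩
    choose! f hf hf2 using this
    refine Finset.card_le_card_of_injOn f hf ?_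
    intro σ hσ τ hτ hst
    by_contra hne
    obtain ⟨x, hx, hxa⟩ := hf2 σ hσ
    obtain ⟨y, hy, hya⟩ := hf2 τ hτ
    have h1 := hsep σ (Finset.mem_filter.mp hσ).1 τ (Finset.mem_filter.mp hτ).1 hne x hx y hy
    rw [← hst] at hya
    have h2 := dist_triangle_right x y (f σ)
    have h3 : t / 2 * diam (J σ) ≤ t / 2 * max (diam (J σ)) (diam (J τ)) := by
      gcongr; exact le_max_left _ _
    have h4 : t / 2 * diam (J τ) ≤ t / 2 * max (diam (J σ)) (diam (J τ)) := by
      gcongr; exact le_max_right _ _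
    linarith
  have hcard : bad.card + good.card = Λ.card := Finset.card_filter_add_card_filter_not _
  have hcard' : (Λ.card : ℝ) - α.card ≤ good.card := by
    rw [← hcard]; push_cast
    have : (bad.card : ℝ) ≤ α.card := by exact_mod_cast hbad
    linarith
  have hgood : ∀ σ ∈ good, σ ∈ Λ := fun σ hσ => (Finset.mem_filter.mp hσ).1
  have hpt : ∀ σ ∈ good, ∀ x ∈ J σ, t / 2 * diam (J σ) ≤ infDist x (α : Set E) := by
    intro σ hσ x hx
    rw [le_infDist (by exact_mod_cast hα)]
    intro a ha
    by_contra hlt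
    exact (Finset.mem_filter.mp hσ).2 ⟨a, by exact_mod_cast ha, x, hx, not_le.mp hlt⟩
  calc ((Λ.card : ℝ) - α.card) * ((t / 2) ^ r * b) ≤ good.card * ((t / 2) ^ r * b) := by
        gcongr
    _ = ∑ σ ∈ good, ((t / 2) ^ r * b) := by simp
    _ ≤ ∑ σ ∈ good, ∫ x in J σ, infDist x (α : Set E) ^ r ∂μ := by
        refine Finset.sum_le_sum fun σ hσ => ?_
        have h1 : (t / 2) ^ r * b ≤ (t / 2 * diam (J σ)) ^ r * μ.real (J σ) := by
          rw [Real.mul_rpow (by positivity) diam_nonneg, mul_assoc]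
          have := hb σ (hgood σ hσ)
          rw [mul_comm (diam (J σ) ^ r)]
          gcongr
        refine h1.trans ?_
        refine setIntegral_ge_of_const_le_real (hJm σ (hgood σ hσ)) (measure_ne_top _ _) ?_ hInt.integrableOn
        intro x hx
        exact Real.rpow_le_rpow (mul_nonneg (by positivity) diam_nonneg) (hpt σ hσ x hx) hr.le
    _ = ∫ x in ⋃ σ ∈ good, J σ, infDist x (α : Set E) ^ r ∂μ := by
        rw [integral_biUnion_finset]
        · exact fun σ hσ => hJm σ (hgood σ hσ)
        · intro σ hσ τ hτ hne
          rw [Function.onFun, Set.disjoint_left]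
          intro x hx hx'
          have h1 := hsep σ (hgood σ hσ) τ (hgood τ hτ) hne x hx x hx'
          rw [dist_self] at h1
          have := mul_pos ht (lt_max_of_lt_left (c := diam (J τ)) (hdiam σ (hgood σ hσ)))
          linarith
        · exact fun σ _ => hInt.integrableOn
    _ ≤ ∫ x, infDist x (α : Set E) ^ r ∂μ :=
        setIntegral_le_integral hInt
          (Eventually.of_forall fun x => Real.rpow_nonneg infDist_nonneg _)

lemma quant_upper {E ι : Type*} [MetricSpace E] [MeasurableSpace E] [BorelSpace E]
    (μ : Measure E) [IsProbabilityMeasure μ] (r : ℝ) (hr : 0 < r) (Λ : Finset ι) (J : ι → Set E)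
    (hΛ : Λ.Nonempty) (hJm : ∀ σ ∈ Λ, MeasurableSet (J σ)) (hJb : ∀ σ ∈ Λ, Bornology.IsBounded (J σ))
    (hJn : ∀ σ ∈ Λ, (J σ).Nonempty) (hdisj : (Λ : Set ι).PairwiseDisjoint J)
    (hmass : ∑ σ ∈ Λ, μ.real (J σ) = 1) (b : ℝ)
    (hb : ∀ σ ∈ Λ, μ.real (J σ) * diam (J σ) ^ r ≤ b) :
    ∃ α : Finset E, 1 ≤ α.card ∧ α.card ≤ Λ.card ∧
      ∫ x, infDist x (α : Set E) ^ r ∂μ ≤ Λ.card * b := by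
  classical
  have hE : Nonempty E := ⟨(hJn _ hΛ.choose_spec).choose⟩
  choose! f hf using hJn
  refine ⟨Λ.image f, ?_, Finset.card_image_le, ?_⟩
  · exact Finset.card_pos.mpr (hΛ.image f)
  have hU : MeasurableSet (⋃ σ ∈ Λ, J σ) := Finset.measurableSet_biUnion _ hJm
  have hU1 : μ.real (⋃ σ ∈ Λ, J σ) = 1 := by
    rw [measureReal_biUnion_finset hdisj hJm, hmass]
  have hae : ∀ᵐ x ∂μ, x ∈ ⋃ σ ∈ Λ, J σ := by
    refine (mem_ae_iff_prob_eq_one hU).mpr ?_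
    rw [Measure.real, ENNReal.toReal_eq_one_iff] at hU1
    exact hU1
  have hbd : Bornology.IsBounded (⋃ σ ∈ Λ, J σ) := by
    rw [Bornology.isBounded_biUnion_finset]; exact hJb
  have hInt := integrable_infDist μ r hr _ hbd hae ((Λ.image f : Finset E) : Set E)
  calc _ = ∫ x in ⋃ σ ∈ Λ, J σ, infDist x ((Λ.image f : Finset E) : Set E) ^ r ∂μ := by
        rw [Measure.restrict_eq_self_of_ae_mem hae]
    _ = ∑ σ ∈ Λ, ∫ x in J σ, infDist x ((Λ.image f : Finset E) : Set E) ^ r ∂μ := by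
        rw [integral_biUnion_finset _ hJm hdisj (fun σ _ => hInt.integrableOn)]
    _ ≤ ∑ σ ∈ Λ, b := by
        refine Finset.sum_le_sum fun σ hσ => ?_
        refine le_trans ?_ (hb σ hσ)
        calc _ ≤ ∫ x in J σ, diam (J σ) ^ r ∂μ := by
              refine setIntegral_mono_on hInt.integrableOn (integrable_const _).integrableOn (hJm σ hσ) ?_
              intro x hx
              refine Real.rpow_le_rpow infDist_nonneg ?_ hr.le
              refine (infDist_le_dist_of_mem (y := f σ) ?_).trans
                (dist_le_diam_of_mem (hJb σ hσ) hx (hf σ hσ))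
              exact_mod_cast Finset.mem_image_of_mem f hσ
          _ = _ := by simp
    _ = _ := by simp

lemma quantError_le {E : Type*} [MetricSpace E] [MeasurableSpace E]
    (P : Measure E) (r : ℝ) (hr : 0 < r) (n : ℕ) (α : Finset E) (h1 : 1 ≤ α.card) (h2 : α.card ≤ n) (b : ℝ)
    (hb : ∫ x, infDist x (↑α : Set E) ^ r ∂P ≤ b) : quantError P r n ≤ b ^ (1 / r) := by
  have h0 : ∀ α : Finset E, 0 ≤ ∫ x, infDist x (↑α : Set E) ^ r ∂P := fun α =>
    integral_nonneg fun x => Real.rpow_nonneg infDist_nonneg _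
  have : (∫ x, infDist x (↑α : Set E) ^ r ∂P) ^ (1 / r) ≤ b ^ (1 / r) :=
    Real.rpow_le_rpow (h0 α) hb (by positivity)
  refine le_trans (csInf_le ⟨0, ?_⟩ ⟨α, h1, h2, rfl⟩) this
  rintro e ⟨β, _, _, rfl⟩
  exact Real.rpow_nonneg (h0 β) _

lemma le_quantError {E : Type*} [MetricSpace E] [MeasurableSpace E] [Nonempty E]
    (P : Measure E) (r : ℝ) (hr : 0 < r) (n : ℕ) (hn : 1 ≤ n) (b : ℝ) (hb0 : 0 ≤ b)
    (hb : ∀ α : Finset E, 1 ≤ α.card → α.card ≤ n → b ≤ ∫ x, infDist x (↑α : Set E) ^ r ∂P) :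
    b ^ (1 / r) ≤ quantError P r n := by
  refine le_csInf ⟨_, {Classical.arbitrary E}, by simp, by simpa using hn, rfl⟩ ?_
  rintro e ⟨β, h1, h2, rfl⟩
  exact Real.rpow_le_rpow hb0 (hb β h1 h2) (by positivity)

/-- final asymptotic step -/
lemma dim_of_bounds (e : ℕ → ℝ) (s : ℝ) (hs : 0 < s) (C : ℝ) (hC : 0 < C)
    (hlow : ∀ n : ℕ, 1 ≤ n → C * (n : ℝ) ^ (-(1 / s)) ≤ e n)
    (hup : ∀ s', s < s' → ∃ D, 0 < D ∧ ∀ᶠ n : ℕ in atTop, e n ≤ D * (n : ℝ) ^ (-(1 / s'))) :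
    Tendsto (fun n : ℕ => Real.log n / (- Real.log (e n))) atTop (nhds s) := by
  have hlog : Tendsto (fun n : ℕ => Real.log n) atTop atTop :=
    Real.tendsto_log_atTop.comp tendsto_natCast_atTop_atTop
  have hg : Tendsto (fun n : ℕ => (- Real.log (e n)) / Real.log n) atTop (nhds (1 / s)) := by
    have haux : ∀ a D : ℝ, Tendsto (fun n : ℕ => a - D / Real.log n) atTop (nhds a) := by
      intro a D
      simpa using (tendsto_const_nhds (x := a)).sub (hlog.const_div_atTop D)
    rw [tendsto_order]
    constructor
    · intro a ha
      obtain ⟨s', hs', ha'⟩ : ∃ s', s < s' ∧ a < 1 / s' := by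
        have hcont : Tendsto (fun x : ℝ => 1 / x) (nhdsWithin s (Set.Ioi s)) (nhds (1 / s)) := by
          have : ContinuousAt (fun x : ℝ => 1 / x) s := by
            simpa using continuousAt_inv₀ hs.ne'
          exact this.tendsto.mono_left nhdsWithin_le_nhds
        obtain ⟨x, hx1, hx2⟩ := ((hcont.eventually (lt_mem_nhds ha)).and self_mem_nhdsWithin).exists
        exact ⟨x, hx2, hx1⟩
      obtain ⟨D, hD, hev⟩ := hup s' hs'
      filter_upwards [hev, (haux (1 / s') (Real.log D)).eventually (lt_mem_nhds ha'),
        hlog.eventually_gt_atTop 0, eventually_ge_atTop 1] with n h1 h2 h3 h4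
      have hn : (0:ℝ) < n := by exact_mod_cast h4
      refine h2.trans_le ?_
      have he : 0 < e n := lt_of_lt_of_le (by positivity) (hlow n h4)
      have h5 := Real.log_le_log he h1
      rw [Real.log_mul hD.ne' (by positivity), Real.log_rpow hn] at h5
      rw [le_div_iff₀ h3, sub_mul, div_mul_cancel₀ _ h3.ne']
      linarith
    · intro b hb
      filter_upwards [(haux (1 / s) (Real.log C)).eventually (gt_mem_nhds hb),
        hlog.eventually_gt_atTop 0, eventually_ge_atTop 1] with n h2 h3 h4
      have hn : (0:ℝ) < n := by exact_mod_cast h4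
      refine lt_of_le_of_lt ?_ h2
      have h5 := Real.log_le_log (by positivity) (hlow n h4)
      rw [Real.log_mul hC.ne' (by positivity), Real.log_rpow hn] at h5
      rw [div_le_iff₀ h3, sub_mul, div_mul_cancel₀ _ h3.ne']
      linarith
  have := hg.inv₀ (by positivity)
  simpa using this

lemma cylMass_step {N : ℕ} (χ : Fin N → ℝ) (p : Fin N → Fin N → ℝ) (σ : List (Fin N))
    (i j : Fin N) : cylMass χ p (σ ++ [i, j]) = cylMass χ p (σ ++ [i]) * p i j := by
  have aux : ∀ (l : List (Fin N)) (a : Fin N),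
      (((a :: (l ++ [i, j])).zip (l ++ [i, j])).map (fun ab => p ab.1 ab.2)).prod =
      (((a :: (l ++ [i])).zip (l ++ [i])).map (fun ab => p ab.1 ab.2)).prod * p i j := by
    intro l
    induction l with
    | nil => intro a; simp
    | cons b l ih =>
      intro a
      have := ih b
      simp only [List.cons_append, List.zip_cons_cons, List.map_cons, List.prod_cons] at this ⊢
      rw [this]; ring
  cases σ with
  | nil => simp [cylMass]
  | cons a l =>
    simp only [List.cons_append, cylMass]
    rw [aux l a]; ring

lemma adm_step {N : ℕ} (p : Fin N → Fin N → ℝ) (σ : List (Fin N))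
    (i j : Fin N) : Adm p (σ ++ [i, j]) ↔ Adm p (σ ++ [i]) ∧ 0 < p i j := by
  unfold Adm
  have : σ ++ [i, j] = σ ++ [i] ++ [j] := by simp
  rw [this]
  change List.IsChain _ _ ↔ List.IsChain _ _ ∧ _
  rw [List.isChain_append]
  simp

lemma adm_prefix {N : ℕ} (p : Fin N → Fin N → ℝ) {σ τ : List (Fin N)} (h : σ <+: τ)
    (hτ : Adm p τ) : Adm p σ := List.IsChain.prefix hτ h

lemma adm_single {N : ℕ} (p : Fin N → Fin N → ℝ) (i : Fin N) : Adm p [i] := by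
  exact List.isChain_singleton i

lemma nil_or_cat {α : Type*} (σ : List α) : σ = [] ∨ ∃ τ a, σ = τ ++ [a] := by
  rcases List.eq_nil_or_concat σ with h | ⟨τ, a, h⟩
  · exact Or.inl h
  · exact Or.inr ⟨τ, a, by simpa using h⟩

lemma diam_pos_base {d : ℕ} (hd : d ≠ 0) (A : Set (EuclideanSpace ℝ (Fin d)))
    (hc : IsCompact A) (hne : A.Nonempty) (h : A = closure (interior A)) : 0 < diam A := by
  have : Nonempty (Fin d) := ⟨⟨0, Nat.pos_of_ne_zero hd⟩⟩
  have hi : (interior A).Nonempty := by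
    rw [← closure_nonempty_iff, ← h]; exact hne
  obtain ⟨x, hx⟩ := hi
  have hA : A.Nontrivial := by
    by_contra hA
    rw [Set.not_nontrivial_iff] at hA
    have : interior A = {x} := (hA.anti interior_subset).eq_singleton_of_mem hx
    exact not_isOpen_singleton x (this ▸ isOpen_interior)
  exact Metric.diam_pos hA hc.isBounded

/-- for a Markov-type measure `μ` on a ratio-specified Mauldin–Williams fractal
(with a row-stochastic matrix `(p_{ij})` whose rows each have at least two positive entries
(A1), and the separation condition (A2)), if `s_r > 0` is such that the spectral radius of the
matrix `((p_{ij} c_{ij}^r)^{s_r/(s_r+r)})` equals one, then the quantization dimension of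
order `r` exists, `D_r(μ) = s_r`, and `Q̲_r^{s_r}(μ) > 0`. -/
theorem quantDim_markov_mauldin_williams (d N : ℕ) (hN : 2 ≤ N)
    (p : Fin N → Fin N → ℝ) (hp0 : ∀ i j, 0 ≤ p i j) (hrow : ∀ i, ∑ j, p i j = 1)
    (hA1 : ∀ i, 2 ≤ (Finset.univ.filter (fun j => 0 < p i j)).card)
    (c : Fin N → Fin N → ℝ) (hc : ∀ i j, 0 < c i j ∧ c i j < 1)
    (J : List (Fin N) → Set (EuclideanSpace ℝ (Fin d)))
    (hJbase : ∀ i : Fin N, IsCompact (J [i]) ∧ (J [i]).Nonempty ∧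
      J [i] = closure (interior (J [i])))
    (hJsub : ∀ (σ : List (Fin N)) (i j : Fin N), Adm p (σ ++ [i, j]) →
      J (σ ++ [i, j]) ⊆ J (σ ++ [i]))
    (hJsim : ∀ (σ : List (Fin N)) (i j : Fin N), Adm p (σ ++ [i, j]) →
      ∃ (S : EuclideanSpace ℝ (Fin d) → EuclideanSpace ℝ (Fin d)) (ρ : ℝ), 0 < ρ ∧
        (∀ x y, dist (S x) (S y) = ρ * dist x y) ∧ S '' J [j] = J (σ ++ [i, j]))
    (hJdiam : ∀ (σ : List (Fin N)) (i j : Fin N), Adm p (σ ++ [i, j]) →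
      diam (J (σ ++ [i, j])) = c i j * diam (J (σ ++ [i])))
    (hA2 : ∃ t : ℝ, 0 < t ∧ t < 1 ∧ ∀ (σ : List (Fin N)) (i₁ i₂ : Fin N), i₁ ≠ i₂ →
      Adm p (σ ++ [i₁]) → Adm p (σ ++ [i₂]) →
      ∀ x ∈ J (σ ++ [i₁]), ∀ y ∈ J (σ ++ [i₂]),
        t * max (diam (J (σ ++ [i₁]))) (diam (J (σ ++ [i₂]))) ≤ dist x y)
    (χ : Fin N → ℝ) (hχ : ∀ i, 0 < χ i) (hχ1 : ∑ i, χ i = 1)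
    (μ : Measure (EuclideanSpace ℝ (Fin d))) [IsProbabilityMeasure μ]
    (hμ : ∀ σ : List (Fin N), σ ≠ [] → Adm p σ → μ (J σ) = ENNReal.ofReal (cylMass χ p σ))
    (r sr : ℝ) (hr : 0 < r) (hsr : 0 < sr)
    (hspec : spectralRadius ℂ (Matrix.of fun i j : Fin N =>
      (((p i j * c i j ^ r) ^ (sr / (sr + r)) : ℝ) : ℂ)) = 1) :
    upperQuantDim μ r = sr ∧ lowerQuantDim μ r = sr ∧ 0 < lowerQuantCoeff μ r sr := by
  classical
  have hcyl1 : ∀ i, cylMass χ p [i] = χ i := fun i => by simp [cylMass]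
  have hd : d ≠ 0 := by
    rintro rfl
    have h1 : ∀ i, χ i = 1 := by
      intro i
      have h2 := hμ [i] (by simp) (adm_single p i)
      have h3 : J [i] = Set.univ := (hJbase i).2.1.eq_univ
      rw [h3, measure_univ, hcyl1] at h2
      exact (ENNReal.ofReal_eq_one.mp h2.symm)
    simp [h1] at hχ1
    omega
  have hNe : Nonempty (Fin N) := ⟨⟨0, by omega⟩⟩
  -- geometry of the cylinders
  have hcomp : ∀ σ, σ ≠ [] → Adm p σ → IsCompact (J σ) ∧ (J σ).Nonempty := by
    intro σ hσ hadm
    obtain ⟨σ, i, rfl⟩ := (nil_or_cat σ).resolve_left hσ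
    rcases nil_or_cat σ with rfl | ⟨σ, k, rfl⟩
    · exact ⟨(hJbase i).1, (hJbase i).2.1⟩
    · have e : σ ++ [k] ++ [i] = σ ++ [k, i] := by simp
      rw [e] at hadm ⊢
      obtain ⟨S, ρ, hρ, hS, himg⟩ := hJsim σ k i hadm
      rw [← himg]
      have hcont : Continuous S := by
        refine (LipschitzWith.of_dist_le_mul (K := ⟨ρ, hρ.le⟩) fun x y => ?_).continuous
        exact (hS x y).le
      exact ⟨(hJbase i).1.image hcont, (hJbase i).2.1.image S⟩
  have hpos : ∀ σ, σ ≠ [] → Adm p σ → 0 < diam (J σ) ∧ 0 < cylMass χ p σ := by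
    intro σ
    induction σ using List.reverseRecOn with
    | nil => intro h; exact absurd rfl h
    | append_singleton σ i ih =>
      intro _ hadm
      rcases nil_or_cat σ with rfl | ⟨σ, k, rfl⟩
      · refine ⟨diam_pos_base hd _ (hJbase i).1 (hJbase i).2.1 (hJbase i).2.2, ?_⟩
        simpa [hcyl1] using hχ i
      · have e : σ ++ [k] ++ [i] = σ ++ [k, i] := by simp
        rw [e] at hadm ⊢
        obtain ⟨h1, h2⟩ := (adm_step p σ k i).mp hadm
        obtain ⟨h3, h4⟩ := ih (by simp) h1
        rw [hJdiam σ k i hadm, cylMass_step]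
        exact ⟨mul_pos (hc k i).1 h3, mul_pos h4 h2⟩
  have hmono : ∀ σ ρ, σ ≠ [] → Adm p (σ ++ ρ) → J (σ ++ ρ) ⊆ J σ := by
    intro σ ρ hσ
    induction ρ using List.reverseRecOn with
    | nil => intro _; simp
    | append_singleton ρ i ih =>
      intro hadm
      have hne : σ ++ ρ ≠ [] := by simp [hσ]
      obtain ⟨τ, k, hτ⟩ := (nil_or_cat (σ ++ ρ)).resolve_left hne
      have e : σ ++ (ρ ++ [i]) = τ ++ [k, i] := by
        rw [← List.append_assoc, hτ]; simp
      have h1 := adm_prefix p (σ := σ ++ ρ) (by rw [← List.append_assoc]; exact List.prefix_append _ _) hadm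
      rw [e] at hadm ⊢
      refine (hJsub τ k i hadm).trans ?_
      have h2 := ih h1
      rw [hτ] at h2
      exact h2
  have hμr : ∀ σ, σ ≠ [] → Adm p σ → μ.real (J σ) = cylMass χ p σ := by
    intro σ h1 h2
    rw [Measure.real, hμ σ h1 h2, ENNReal.toReal_ofReal (hpos σ h1 h2).2.le]
  obtain ⟨t, ht0, ht1, hsep⟩ := hA2
  have hsep2 : ∀ σ τ, Adm p σ → Adm p τ → (∃ ω i j, i ≠ j ∧ Adm p (ω ++ [i]) ∧ Adm p (ω ++ [j]) ∧
      ω ++ [i] <+: σ ∧ ω ++ [j] <+: τ) → ∀ x ∈ J σ, ∀ y ∈ J τ,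
        t * max (diam (J σ)) (diam (J τ)) ≤ dist x y := by
    rintro σ τ hσ hτ ⟨ω, i, j, hij, ha, hb, ⟨ρ1, rfl⟩, ⟨ρ2, rfl⟩⟩ x hx y hy
    have m1 := hmono _ _ (by simp) hσ
    have m2 := hmono _ _ (by simp) hτ
    have := hsep ω i j hij ha hb x (m1 hx) y (m2 hy)
    refine le_trans ?_ this
    have d1 := diam_mono m1 (hcomp _ (by simp) ha).1.isBounded
    have d2 := diam_mono m2 (hcomp _ (by simp) hb).1.isBounded
    gcongr
  -- constants
  obtain ⟨⟨i0, j0⟩, hmax⟩ := Finite.exists_max (fun x : Fin N × Fin N => p x.1 x.2 * c x.1 x.2 ^ r)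
  have hp1 : ∀ i j, p i j ≤ 1 := fun i j => by
    rw [← hrow i]; exact Finset.single_le_sum (fun k _ => hp0 i k) (Finset.mem_univ j)
  have hpc0 : ∀ i j, 0 ≤ p i j * c i j ^ r := fun i j =>
    mul_nonneg (hp0 i j) (Real.rpow_nonneg (hc i j).1.le _)
  have hpc1 : ∀ i j, p i j * c i j ^ r < 1 := fun i j => by
    have h1 := Real.rpow_lt_one (hc i j).1.le (hc i j).2 hr
    have h2 : 0 ≤ c i j ^ r := Real.rpow_nonneg (hc i j).1.le _
    nlinarith [hp1 i j, hp0 i j]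
  obtain ⟨θ, hθ0, hθ1, hθ⟩ : ∃ θ : ℝ, 0 < θ ∧ θ < 1 ∧ ∀ i j, p i j * c i j ^ r ≤ θ := by
    have h1 := hpc1 i0 j0
    have h0 := hpc0 i0 j0
    refine ⟨(p i0 j0 * c i0 j0 ^ r + 1) / 2, by linarith, by linarith, fun i j => ?_⟩
    have := hmax (i, j)
    simp only at this
    linarith
  let H0 : List (Fin N) → ℝ := fun σ => cylMass χ p σ * diam (J σ) ^ r
  have hH0pos : ∀ σ, σ ≠ [] → Adm p σ → 0 < H0 σ := fun σ h1 h2 =>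
    mul_pos (hpos σ h1 h2).2 (Real.rpow_pos_of_pos (hpos σ h1 h2).1 _)
  have hH0step : ∀ σ i j, Adm p (σ ++ [i, j]) →
      H0 (σ ++ [i, j]) = p i j * c i j ^ r * H0 (σ ++ [i]) := by
    intro σ i j h
    simp only [H0]
    rw [cylMass_step, hJdiam σ i j h, Real.mul_rpow (hc i j).1.le diam_nonneg]
    ring
  obtain ⟨D, hD0, hD⟩ : ∃ D : ℝ, 0 < D ∧ ∀ i, H0 [i] ≤ θ * D := by
    obtain ⟨i1, hi1⟩ := Finite.exists_max (fun i : Fin N => H0 [i])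
    refine ⟨H0 [i1] / θ, div_pos (hH0pos _ (by simp) (adm_single p _)) hθ0, fun i => ?_⟩
    rw [mul_div_cancel₀ _ hθ0.ne']
    exact hi1 i
  let H : List (Fin N) → ℝ := fun σ => if σ = [] then D else H0 σ
  have hHnil : H [] = D := by simp [H]
  have hHne : ∀ σ, σ ≠ [] → H σ = H0 σ := fun σ h => by simp [H, h]
  obtain ⟨η, hη0, hη1, hη2⟩ : ∃ η : ℝ, 0 < η ∧ (∀ i j, 0 < p i j → η ≤ p i j * c i j ^ r) ∧
      ∀ i, η * D ≤ H0 [i] := by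
    obtain ⟨x, hx⟩ := Finite.exists_min
      (fun x : Fin N × Fin N => if 0 < p x.1 x.2 then p x.1 x.2 * c x.1 x.2 ^ r else 1)
    obtain ⟨i1, hi1⟩ := Finite.exists_min (fun i : Fin N => H0 [i])
    refine ⟨min (if 0 < p x.1 x.2 then p x.1 x.2 * c x.1 x.2 ^ r else 1) (H0 [i1] / D), ?_, ?_, ?_⟩
    · refine lt_min ?_ (div_pos (hH0pos _ (by simp) (adm_single p _)) hD0)
      split_ifs with h
      · exact mul_pos h (Real.rpow_pos_of_pos (hc _ _).1 _)
      · exact one_pos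
    · intro i j hij
      have := hx (i, j)
      simp only [hij, if_true] at this
      exact (min_le_left _ _).trans this
    · intro i
      rw [← le_div_iff₀ hD0]
      refine (min_le_right _ _).trans ?_
      have := hi1 i
      gcongr
  have hcut : ∀ ε, 0 < ε → ε ≤ D → ∃ Λ : Finset (List (Fin N)),
      (∀ τ ∈ Λ, Adm p τ ∧ τ ≠ [] ∧ H0 τ < ε ∧ η * ε ≤ H0 τ) ∧
      (∀ τ ∈ Λ, ∀ τ' ∈ Λ, τ ≠ τ' → ∀ x ∈ J τ, ∀ y ∈ J τ',
        t * max (diam (J τ)) (diam (J τ')) ≤ dist x y) ∧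
      ∀ w : List (Fin N) → ℝ, w [] ≤ ∑ i, w [i] → (∀ σ i, Adm p (σ ++ [i]) →
        w (σ ++ [i]) ≤ ∑ j ∈ Finset.univ.filter (fun j => 0 < p i j), w (σ ++ [i, j])) →
        w [] ≤ ∑ τ ∈ Λ, w τ := by
    intro ε hε hεD
    obtain ⟨K, hK⟩ := exists_pow_lt_of_lt_one (div_pos hε hD0) hθ1
    have hstep : ∀ σ j, Adm p (σ ++ [j]) → η * H σ ≤ H (σ ++ [j]) ∧ H (σ ++ [j]) ≤ θ * H σ := by
      intro σ j hadm
      rw [hHne (σ ++ [j]) (by simp)]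
      rcases nil_or_cat σ with rfl | ⟨σ, k, rfl⟩
      · rw [hHnil]; exact ⟨hη2 j, hD j⟩
      · have e : σ ++ [k] ++ [j] = σ ++ [k, j] := by simp
        rw [e] at hadm ⊢
        obtain ⟨h1, h2⟩ := (adm_step p σ k j).mp hadm
        rw [hHne (σ ++ [k]) (by simp), hH0step σ k j hadm]
        have h3 := hH0pos (σ ++ [k]) (by simp) h1
        exact ⟨mul_le_mul_of_nonneg_right (hη1 k j h2) h3.le,
          mul_le_mul_of_nonneg_right (hθ k j) h3.le⟩
    obtain ⟨Λ, hΛ1, hΛ2, hΛ3⟩ := cut_exists (Adm p) H θ η ε hη0.le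
      (fun σ j h => (hstep σ j h).1) (fun σ j h => (hstep σ j h).2) hθ0.le K []
      List.isChain_nil (by rw [hHnil]; exact hεD)
      (by rw [hHnil]; exact (lt_div_iff₀ hD0).mp hK)
    refine ⟨Λ, ?_, ?_, ?_⟩
    · intro τ hτ
      obtain ⟨h1, ⟨j, h2⟩, h3, h4⟩ := hΛ1 τ hτ
      have hne : τ ≠ [] := by
        rintro rfl
        simp at h2
      rw [hHne τ hne] at h3 h4
      exact ⟨h1, hne, h3, h4⟩
    · intro τ hτ τ' hτ' hne
      exact hsep2 τ τ' (hΛ1 τ hτ).1 (hΛ1 τ' hτ').1 (hΛ2 τ hτ τ' hτ' hne)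
    · intro w hw0 hw
      refine hΛ3 w ?_
      intro σ hσ
      rcases nil_or_cat σ with rfl | ⟨σ, k, rfl⟩
      · have : Finset.univ.filter (fun j => Adm p ([] ++ [j])) = Finset.univ := by
          ext j; simp [adm_single p j]
        rw [this]; exact hw0
      · have : Finset.univ.filter (fun j => Adm p (σ ++ [k] ++ [j])) =
            Finset.univ.filter (fun j => 0 < p k j) := by
          ext j
          have e : σ ++ [k] ++ [j] = σ ++ [k, j] := by simp
          simp only [e, adm_step, Finset.mem_filter, Finset.mem_univ, true_and]
          exact ⟨fun h => h.2, fun h => ⟨hσ, h⟩⟩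
        rw [this]
        simpa using hw σ k hσ
  have hsumfilter : ∀ (i : Fin N) (f : Fin N → ℝ), (∀ j, p i j = 0 → f j = 0) →
      ∑ j ∈ Finset.univ.filter (fun j => 0 < p i j), f j = ∑ j, f j := by
    intro i f hf
    refine Finset.sum_subset (Finset.subset_univ _) ?_
    intro j _ hj
    refine hf j (le_antisymm ?_ (hp0 i j))
    simpa using hj
  have hAdmFilter : ∀ σ i j, Adm p (σ ++ [i]) → j ∈ Finset.univ.filter (fun j => 0 < p i j) →
      Adm p (σ ++ [i, j]) := by
    intro σ i j h1 h2
    exact (adm_step p σ i j).mpr ⟨h1, by simpa using h2⟩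
  -- powers
  let W : ℝ → (Fin N → ℝ) → List (Fin N) → ℝ := fun q v σ =>
    if σ = [] then ∑ i, H0 [i] ^ q * v i else H0 σ ^ q * (σ.getLast?.elim 0 v)
  have hWnil : ∀ q v, W q v [] = ∑ i, H0 [i] ^ q * v i := fun q v => by simp [W]
  have hWcat : ∀ q v σ i, W q v (σ ++ [i]) = H0 (σ ++ [i]) ^ q * v i := fun q v σ i => by simp [W]
  have hWsum : ∀ q v, ∑ i, W q v [i] = W q v [] := fun q v => by
    rw [hWnil]
    exact Finset.sum_congr rfl fun i _ => hWcat q v [] i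
  have hWstep : ∀ q v σ i, 0 < q → Adm p (σ ++ [i]) →
      ∑ j ∈ Finset.univ.filter (fun j => 0 < p i j), W q v (σ ++ [i, j]) =
        H0 (σ ++ [i]) ^ q * ∑ j, (p i j * c i j ^ r) ^ q * v j := by
    intro q v σ i hq hadm
    rw [← hsumfilter i (fun j => (p i j * c i j ^ r) ^ q * v j), Finset.mul_sum]
    · refine Finset.sum_congr rfl fun j hj => ?_
      have h1 := hAdmFilter σ i j hadm hj
      have e : σ ++ [i, j] = (σ ++ [i]) ++ [j] := by simp
      rw [e, hWcat, ← e, hH0step σ i j h1,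
        Real.mul_rpow (hpc0 i j) (hH0pos (σ ++ [i]) (by simp) hadm).le]
      ring
    · intro j hj
      rw [hj, zero_mul, Real.zero_rpow hq.ne', zero_mul]
  -- support
  have hSb : Bornology.IsBounded (⋃ i ∈ (Finset.univ : Finset (Fin N)), J [i]) := by
    rw [Bornology.isBounded_biUnion_finset]
    exact fun i _ => (hJbase i).1.isBounded
  have hdisj : ∀ Λ : Finset (List (Fin N)), (∀ τ ∈ Λ, Adm p τ ∧ τ ≠ []) →
      (∀ τ ∈ Λ, ∀ τ' ∈ Λ, τ ≠ τ' → ∀ x ∈ J τ, ∀ y ∈ J τ',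
        t * max (diam (J τ)) (diam (J τ')) ≤ dist x y) → (Λ : Set (List (Fin N))).PairwiseDisjoint J := by
    intro Λ h1 h2 τ hτ τ' hτ' hne
    rw [Function.onFun, Set.disjoint_left]
    intro x hx hx'
    have h3 := h2 τ hτ τ' hτ' hne x hx x hx'
    rw [dist_self] at h3
    have := mul_pos ht0 (lt_max_of_lt_left (c := diam (J τ')) (hpos τ (h1 τ hτ).2 (h1 τ hτ).1).1)
    linarith
  have hSμ : ∀ᵐ x ∂μ, x ∈ ⋃ i ∈ (Finset.univ : Finset (Fin N)), J [i] := by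
    have hm : ∀ i ∈ (Finset.univ : Finset (Fin N)), MeasurableSet (J [i]) :=
      fun i _ => (hJbase i).1.measurableSet
    refine (mem_ae_iff_prob_eq_one (Finset.measurableSet_biUnion _ hm)).mpr ?_
    have : μ.real (⋃ i ∈ (Finset.univ : Finset (Fin N)), J [i]) = 1 := by
      rw [measureReal_biUnion_finset _ hm, ← hχ1]
      · refine Finset.sum_congr rfl fun i _ => ?_
        rw [hμr _ (by simp) (adm_single p i), hcyl1]
      · intro i _ j _ hij
        rw [Function.onFun, Set.disjoint_left]
        intro x hx hx'
        have h3 := hsep [] i j hij (adm_single p i) (adm_single p j) x hx x hx'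
        rw [dist_self] at h3
        have := mul_pos ht0 (lt_max_of_lt_left (c := diam (J ([] ++ [j])))
          (hpos [i] (by simp) (adm_single p i)).1)
        simp only [List.nil_append] at h3 this
        linarith
    rw [Measure.real, ENNReal.toReal_eq_one_iff] at this
    exact this
  have hlow : ∃ C, 0 < C ∧ ∀ n : ℕ, 1 ≤ n → C * (n : ℝ) ^ (-(1 / sr)) ≤ quantError μ r n := by
    have hq0 : 0 < sr / (sr + r) := by positivity
    obtain ⟨v, hv0, ⟨i1, hi1⟩, hv⟩ := sup_vec (fun i j => (p i j * c i j ^ r) ^ (sr / (sr + r)))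
      (fun i j => Real.rpow_nonneg (hpc0 i j) _) hspec
    have hexp : (1 - 1 / (sr / (sr + r))) * (1 / r) = -(1 / sr) := by
      field_simp; ring
    set q := sr / (sr + r) with hq
    have hW0 : 0 < W q v [] := by
      rw [hWnil]
      refine Finset.sum_pos' (fun i _ => mul_nonneg (Real.rpow_nonneg
        (hH0pos _ (by simp) (adm_single p i)).le _) (hv0 i)) ⟨i1, Finset.mem_univ _, ?_⟩
      exact mul_pos (Real.rpow_pos_of_pos (hH0pos _ (by simp) (adm_single p i1)) _) hi1
    obtain ⟨i2, hi2⟩ := Finite.exists_max v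
    have hV : 0 < v i2 := hi1.trans_le (hi2 i1)
    set c0 := min (W q v [] / v i2) (D ^ q) with hc0
    have hc0pos : 0 < c0 := lt_min (div_pos hW0 hV) (Real.rpow_pos_of_pos hD0 _)
    set X := (t / 2) ^ r * (η * (c0 / 2) ^ (1 / q)) with hX
    have hXpos : 0 < X := by positivity
    refine ⟨X ^ (1 / r), by positivity, fun n hn => ?_⟩
    have hn' : (1 : ℝ) ≤ n := by exact_mod_cast hn
    have hn0 : (0 : ℝ) < n := by linarith
    set ε := (c0 / (2 * n)) ^ (1 / q) with hε
    have hεpos : 0 < ε := by positivity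
    have hεq : ε ^ q = c0 / (2 * n) := by
      rw [hε, ← Real.rpow_mul (by positivity), one_div_mul_cancel hq0.ne', Real.rpow_one]
    have hεD : ε ≤ D := by
      have h1 : c0 / (2 * n) ≤ D ^ q :=
        (div_le_self hc0pos.le (by linarith)).trans (min_le_right _ _)
      rw [← hεq] at h1
      exact (Real.rpow_le_rpow_iff hεpos.le hD0.le hq0).mp h1
    obtain ⟨Λ, hΛ1, hΛ2, hΛ3⟩ := hcut ε hεpos hεD
    have hflow : W q v [] ≤ ∑ τ ∈ Λ, W q v τ := by
      refine hΛ3 (W q v) (hWsum q v).ge ?_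
      intro σ i hadm
      rw [hWstep q v σ i hq0 hadm, hWcat]
      exact mul_le_mul_of_nonneg_left (hv i)
        (Real.rpow_nonneg (hH0pos _ (by simp) hadm).le _)
    have hcardΛ : 2 * (n : ℝ) ≤ Λ.card := by
      have h1 : ∑ τ ∈ Λ, W q v τ ≤ ∑ τ ∈ Λ, ε ^ q * v i2 := by
        refine Finset.sum_le_sum fun τ hτ => ?_
        obtain ⟨g1, g2, g3, g4⟩ := hΛ1 τ hτ
        obtain ⟨σ, i, rfl⟩ := (nil_or_cat τ).resolve_left g2
        rw [hWcat]
        exact mul_le_mul (Real.rpow_le_rpow (hH0pos _ g2 g1).le g3.le hq0.le) (hi2 i) (hv0 i)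
          (Real.rpow_nonneg hεpos.le _)
      rw [Finset.sum_const, nsmul_eq_mul] at h1
      have h2 : c0 ≤ Λ.card * ε ^ q := by
        refine (min_le_left _ _).trans ?_
        rw [div_le_iff₀ hV, mul_assoc]
        exact hflow.trans h1
      rw [hεq] at h2
      have h3 : c0 * (2 * n) ≤ c0 * Λ.card := by
        have h4 := mul_le_mul_of_nonneg_right h2 (by positivity : (0:ℝ) ≤ 2 * n)
        rw [mul_assoc, div_mul_cancel₀ _ (by positivity)] at h4
        linarith
      exact le_of_mul_le_mul_left h3 hc0pos
    have hb : X ^ (1 / r) * (n : ℝ) ^ (-(1 / sr)) = (n * ((t / 2) ^ r * (η * ε))) ^ (1 / r) := by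
      have h1 : n * ((t / 2) ^ r * (η * ε)) = X * (n : ℝ) ^ (1 - 1 / q) := by
        have h2 : ε = (c0 / 2) ^ (1 / q) * (n : ℝ) ^ (-(1 / q)) := by
          rw [hε, ← div_div, Real.div_rpow (by positivity) hn0.le, Real.rpow_neg hn0.le,
            div_eq_mul_inv]
        rw [h2, sub_eq_add_neg, Real.rpow_add hn0, Real.rpow_one, hX]
        ring
      rw [h1, Real.mul_rpow hXpos.le (by positivity), ← Real.rpow_mul hn0.le, hexp]
    rw [hb]
    refine le_quantError μ r hr n hn _ (by positivity) ?_
    intro α hα1 hα2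
    refine le_trans ?_ (quant_lower μ r hr _ hSb hSμ Λ J
      (fun σ hσ => (hcomp σ (hΛ1 σ hσ).2.1 (hΛ1 σ hσ).1).1.measurableSet) t ht0 hΛ2
      (fun σ hσ => (hpos σ (hΛ1 σ hσ).2.1 (hΛ1 σ hσ).1).1) (η * ε) (by positivity) ?_ α
      (Finset.card_pos.mp hα1))
    · have : (α.card : ℝ) ≤ n := by exact_mod_cast hα2
      refine mul_le_mul_of_nonneg_right ?_ (by positivity)
      linarith
    · intro σ hσ
      obtain ⟨g1, g2, g3, g4⟩ := hΛ1 σ hσ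
      rw [hμr σ g2 g1]
      exact g4
  have hup : ∀ s', sr < s' → ∃ C, 0 < C ∧ ∀ᶠ n : ℕ in atTop,
      quantError μ r n ≤ C * (n : ℝ) ^ (-(1 / s')) := by
    intro s' hs'
    have hs'0 : 0 < s' := hsr.trans hs'
    have hq0 : 0 < s' / (s' + r) := by positivity
    have hqq : sr / (sr + r) < s' / (s' + r) := by
      rw [div_lt_div_iff₀ (by positivity) (by positivity)]
      nlinarith
    have hexp : (1 - 1 / (s' / (s' + r))) * (1 / r) = -(1 / s') := by
      field_simp; ring
    set q := s' / (s' + r) with hq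
    obtain ⟨v, hv1, hv⟩ := sub_vec (fun i j => (p i j * c i j ^ r) ^ (sr / (sr + r)))
      (fun i j => Real.rpow_nonneg (hpc0 i j) _) hspec (θ ^ (q - sr / (sr + r)))
      (Real.rpow_pos_of_pos hθ0 _) (Real.rpow_lt_one hθ0.le hθ1 (by linarith))
    have hv' : ∀ i, ∑ j, (p i j * c i j ^ r) ^ q * v j ≤ v i := by
      intro i
      refine le_trans (Finset.sum_le_sum fun j _ => ?_) (hv i)
      refine mul_le_mul_of_nonneg_right ?_ (zero_le_one.trans (hv1 j))
      rcases (hpc0 i j).eq_or_lt with h | h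
      · rw [← h, Real.zero_rpow hq0.ne']
        exact mul_nonneg (Real.rpow_nonneg hθ0.le _) (Real.rpow_nonneg le_rfl _)
      · have e : (p i j * c i j ^ r) ^ q = (p i j * c i j ^ r) ^ (q - sr / (sr + r)) *
            (p i j * c i j ^ r) ^ (sr / (sr + r)) := by
          rw [← Real.rpow_add h]; congr 1; ring
        rw [e]
        exact mul_le_mul_of_nonneg_right (Real.rpow_le_rpow h.le (hθ i j) (by linarith))
          (Real.rpow_nonneg h.le _)
    have hW0 : 0 < W q v [] := by
      rw [hWnil]
      refine Finset.sum_pos (fun i _ => mul_pos (Real.rpow_pos_of_pos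
        (hH0pos _ (by simp) (adm_single p i)) _) (zero_lt_one.trans_le (hv1 i)))
        Finset.univ_nonempty
    set W0 := W q v [] with hW0def
    set X := W0 ^ (1 / q) / η with hX
    have hXpos : 0 < X := by positivity
    refine ⟨X ^ (1 / r), by positivity, ?_⟩
    filter_upwards [eventually_ge_atTop 1,
      tendsto_natCast_atTop_atTop.eventually_ge_atTop (W0 / (η * D) ^ q)] with n hn hnD
    have hn0 : (0 : ℝ) < n := by exact_mod_cast hn
    set ε := (W0 / n) ^ (1 / q) / η with hε
    have hεpos : 0 < ε := by positivity
    have hεη : η * ε = (W0 / n) ^ (1 / q) := by rw [hε, mul_div_cancel₀ _ hη0.ne']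
    have hεq : (η * ε) ^ q = W0 / n := by
      rw [hεη, ← Real.rpow_mul (by positivity), one_div_mul_cancel hq0.ne', Real.rpow_one]
    have hεD : ε ≤ D := by
      have h1 : (η * ε) ^ q ≤ (η * D) ^ q := by
        rw [hεq, div_le_iff₀ hn0, mul_comm]
        exact (div_le_iff₀ (by positivity)).mp hnD
      have h2 := (Real.rpow_le_rpow_iff (by positivity) (by positivity) hq0).mp h1
      exact le_of_mul_le_mul_left h2 hη0
    obtain ⟨Λ, hΛ1, hΛ2, hΛ3⟩ := hcut ε hεpos hεD
    have hflow : ∑ τ ∈ Λ, W q v τ ≤ W0 := by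
      have := hΛ3 (fun τ => - W q v τ) (by rw [Finset.sum_neg_distrib, hWsum]) (by
        intro σ i hadm
        rw [Finset.sum_neg_distrib, hWstep q v σ i hq0 hadm, hWcat]
        exact neg_le_neg (mul_le_mul_of_nonneg_left (hv' i)
          (Real.rpow_nonneg (hH0pos _ (by simp) hadm).le _)))
      rw [Finset.sum_neg_distrib] at this
      exact neg_le_neg_iff.mp this
    have hcardΛ : Λ.card ≤ n := by
      have h1 : ∑ τ ∈ Λ, (η * ε) ^ q ≤ ∑ τ ∈ Λ, W q v τ := by
        refine Finset.sum_le_sum fun τ hτ => ?_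
        obtain ⟨g1, g2, g3, g4⟩ := hΛ1 τ hτ
        obtain ⟨σ, i, rfl⟩ := (nil_or_cat τ).resolve_left g2
        rw [hWcat]
        have h2 := Real.rpow_le_rpow (by positivity) g4 hq0.le
        exact h2.trans (le_mul_of_one_le_right (Real.rpow_nonneg (hH0pos _ g2 g1).le _) (hv1 i))
      rw [Finset.sum_const, nsmul_eq_mul, hεq] at h1
      have h2 := h1.trans hflow
      have h3 : (Λ.card : ℝ) * W0 ≤ n * W0 := by
        rw [← mul_div_assoc, div_le_iff₀ hn0] at h2
        linarith
      exact_mod_cast le_of_mul_le_mul_right h3 hW0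
    have hmstep : ∀ σ i, ∑ j ∈ Finset.univ.filter (fun j => 0 < p i j), cylMass χ p (σ ++ [i, j]) =
        cylMass χ p (σ ++ [i]) := by
      intro σ i
      rw [hsumfilter i (fun j => cylMass χ p (σ ++ [i, j]))]
      · simp only [cylMass_step]
        rw [← Finset.mul_sum, hrow, mul_one]
      · intro j hj
        rw [cylMass_step, hj, mul_zero]
    have hmroot : ∑ i, cylMass χ p [i] = cylMass χ p [] := by
      rw [Finset.sum_congr rfl (fun i _ => hcyl1 i), hχ1]; rfl
    have hmass : ∑ τ ∈ Λ, cylMass χ p τ = 1 := by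
      have h1 := hΛ3 (cylMass χ p) hmroot.ge (fun σ i _ => (hmstep σ i).ge)
      have h2 := hΛ3 (fun τ => - cylMass χ p τ) (by rw [Finset.sum_neg_distrib, hmroot])
        (fun σ i _ => by rw [Finset.sum_neg_distrib, hmstep σ i])
      rw [Finset.sum_neg_distrib] at h2
      have h3 : cylMass χ p [] = 1 := rfl
      rw [h3] at h1 h2
      linarith
    have hΛne : Λ.Nonempty := by
      rw [Finset.nonempty_iff_ne_empty]
      rintro rfl
      simp at hmass
    have hΛc := fun σ hσ => hcomp σ (hΛ1 σ hσ).2.1 (hΛ1 σ hσ).1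
    obtain ⟨α, hα1, hα2, hα3⟩ := quant_upper μ r hr Λ J hΛne
      (fun σ hσ => (hΛc σ hσ).1.measurableSet) (fun σ hσ => (hΛc σ hσ).1.isBounded)
      (fun σ hσ => (hΛc σ hσ).2) (hdisj Λ (fun σ hσ => ⟨(hΛ1 σ hσ).1, (hΛ1 σ hσ).2.1⟩) hΛ2)
      (by
        rw [← hmass]
        exact Finset.sum_congr rfl fun σ hσ => hμr σ (hΛ1 σ hσ).2.1 (hΛ1 σ hσ).1)
      ε (fun σ hσ => by
        rw [hμr σ (hΛ1 σ hσ).2.1 (hΛ1 σ hσ).1]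
        exact (hΛ1 σ hσ).2.2.1.le)
    have hfin := quantError_le μ r hr n α hα1 (hα2.trans hcardΛ) (n * ε) (hα3.trans (by
      have : (Λ.card : ℝ) ≤ n := by exact_mod_cast hcardΛ
      gcongr))
    refine hfin.trans_eq ?_
    have h1 : n * ε = X * (n : ℝ) ^ (1 - 1 / q) := by
      rw [hε, Real.div_rpow hW0.le hn0.le, sub_eq_add_neg, Real.rpow_add hn0, Real.rpow_one,
        Real.rpow_neg hn0.le, hX]
      ring
    rw [h1, Real.mul_rpow hXpos.le (by positivity), ← Real.rpow_mul hn0.le, hexp]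
  obtain ⟨C, hC, hlow⟩ := hlow
  have hT := dim_of_bounds (quantError μ r) sr hsr C hC hlow hup
  refine ⟨hT.limsup_eq, hT.liminf_eq, ?_⟩
  refine lt_of_lt_of_le (ENNReal.ofReal_pos.mpr hC) (le_liminf_of_le (by isBoundedDefault) ?_)
  filter_upwards [eventually_ge_atTop 1] with n hn
  have hn' : (0:ℝ) < n := by exact_mod_cast hn
  refine ENNReal.ofReal_le_ofReal ?_
  calc C = (n : ℝ) ^ (1 / sr) * (C * (n : ℝ) ^ (-(1 / sr))) := by
        rw [mul_left_comm, ← Real.rpow_add hn']; simp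
    _ ≤ _ := mul_le_mul_of_nonneg_left (hlow n hn) (by positivity)
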